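/- arXiv:2406.00328 — 3 statements merged into one kernel-verified Lean document; each statement's English description precedes it below -/
import Mathlib

section
/- There is a universal constant C > 0 such that the following holds. Let 2 ≤ q < ∞, let w ∈ ℝ^m with w_i ≥ 1 for all i, let A' ∈ ℝ^{m×d} satisfy A'^T·diag(w)·A' = I_d (orthonormality with respect to the weighted ℓ_2 inner product), and let τ ≥ max_{i∈[m]} w_i·‖a_i'‖_2^2, where a_i' are the rows of A'. Then for every t > 0 there exists a finite set N ⊆ ℝ^d with log|N| ≤ C·m^{2/q}·q·τ/t^2 such that for every x ∈ ℝ^d with ‖A'x‖_{w,2} ≤ 1 there exists x' ∈ N with ‖A'(x − x')‖_{w,q} ≤ t. -/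
open Matrix

/-- The weighted `ℓ_q` norm `‖v‖_{w,q} = (∑_i w_i |v_i|^q)^{1/q}`. -/
noncomputable def wNorm {m : ℕ} (w : Fin m → ℝ) (q : ℝ) (v : Fin m → ℝ) : ℝ :=
  (∑ i, w i * |v i| ^ q) ^ (1 / q)

open MeasureTheory

/-- The unnormalised centred Gaussian density of variance `1 / c` on `ℝ^d`. -/
noncomputable def gaussWeight {d : ℕ} (c : ℝ) (x : Fin d → ℝ) : ℝ :=
  Real.exp (-(c / 2) * (x ⬝ᵥ x))

lemma gaussWeight_pos {d : ℕ} (c : ℝ) (x : Fin d → ℝ) : 0 < gaussWeight c x :=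
  Real.exp_pos _

lemma gaussWeight_neg {d : ℕ} (c : ℝ) (x : Fin d → ℝ) :
    gaussWeight c (-x) = gaussWeight c x := by
  simp [gaussWeight]

lemma integrable_gaussWeight {d : ℕ} {c : ℝ} (hc : 0 < c) :
    Integrable (gaussWeight c : (Fin d → ℝ) → ℝ) := by
  have h : (gaussWeight c : (Fin d → ℝ) → ℝ) =
      fun x => ∏ i, Real.exp (-(c / 2) * x i ^ 2) := by
    funext x
    rw [← Real.exp_sum, ← Finset.mul_sum]
    simp [gaussWeight, dotProduct, sq]
  rw [h]
  exact Integrable.fintype_prod (f := fun _ : Fin d => fun y : ℝ => Real.exp (-(c / 2) * y ^ 2))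
    fun _ => integrable_exp_neg_mul_sq (by positivity)

lemma integral_gaussWeight_pos {d : ℕ} {c : ℝ} (hc : 0 < c) :
    0 < ∫ x : Fin d → ℝ, gaussWeight c x := by
  have hs : Function.support (gaussWeight c : (Fin d → ℝ) → ℝ) = Set.univ :=
    Set.eq_univ_of_forall fun x => (gaussWeight_pos c x).ne'
  rw [integral_pos_iff_support_of_nonneg (fun x => (gaussWeight_pos c x).le)
    (integrable_gaussWeight hc), hs]
  exact Measure.measure_univ_pos.2 (NeZero.ne _)

lemma exp_dotProduct_mul_gaussWeight {d : ℕ} {c : ℝ} (hc : 0 < c) (u x : Fin d → ℝ) :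
    Real.exp (u ⬝ᵥ x) * gaussWeight c x =
      Real.exp (u ⬝ᵥ u / (2 * c)) * gaussWeight c (x - c⁻¹ • u) := by
  simp only [gaussWeight, ← Real.exp_add]
  congr 1
  simp only [sub_dotProduct, dotProduct_sub, smul_dotProduct, dotProduct_smul, smul_eq_mul,
    dotProduct_comm x u]
  field_simp
  ring

lemma integrable_exp_dotProduct_mul_gaussWeight {d : ℕ} {c : ℝ} (hc : 0 < c) (u : Fin d → ℝ) :
    Integrable fun x => Real.exp (u ⬝ᵥ x) * gaussWeight c x := by
  simp only [exp_dotProduct_mul_gaussWeight hc u]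
  exact ((integrable_gaussWeight hc).comp_sub_right _).const_mul _

lemma integral_exp_dotProduct_mul_gaussWeight {d : ℕ} {c : ℝ} (hc : 0 < c) (u : Fin d → ℝ) :
    ∫ x, Real.exp (u ⬝ᵥ x) * gaussWeight c x =
      Real.exp (u ⬝ᵥ u / (2 * c)) * ∫ x : Fin d → ℝ, gaussWeight c x := by
  simp only [exp_dotProduct_mul_gaussWeight hc u]
  rw [integral_const_mul, integral_sub_right_eq_self]

lemma exp_mul_gaussWeight_le {d : ℕ} (c : ℝ) (y z : Fin d → ℝ) :
    Real.exp (-(c / 2) * (y ⬝ᵥ y)) * gaussWeight c z ≤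
      (gaussWeight c (z + y) + gaussWeight c (-z + y)) / 2 := by
  have h1 : gaussWeight c (z + y) =
      Real.exp (-(c / 2) * (y ⬝ᵥ y)) * gaussWeight c z * Real.exp (-c * (z ⬝ᵥ y)) := by
    simp only [gaussWeight, ← Real.exp_add]
    congr 1
    simp only [add_dotProduct, dotProduct_add, dotProduct_comm y z]
    ring
  have h2 : gaussWeight c (-z + y) =
      Real.exp (-(c / 2) * (y ⬝ᵥ y)) * gaussWeight c z * Real.exp (-(-c * (z ⬝ᵥ y))) := by
    simp only [gaussWeight, ← Real.exp_add]
    congr 1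
    simp only [add_dotProduct, dotProduct_add, neg_dotProduct,
      dotProduct_neg, dotProduct_comm y z]
    ring
  have h3 := Real.one_le_cosh (-c * (z ⬝ᵥ y))
  rw [Real.cosh_eq] at h3
  have h4 : 0 < Real.exp (-(c / 2) * (y ⬝ᵥ y)) * gaussWeight c z :=
    mul_pos (Real.exp_pos _) (gaussWeight_pos _ _)
  rw [h1, h2]
  nlinarith

/-- Translating a symmetric set by `y` decreases its Gaussian mass at most by the factor
`exp (-c ‖y‖² / 2)`. -/
lemma exp_mul_integral_indicator_le {d : ℕ} {c : ℝ} (hc : 0 < c) {K : Set (Fin d → ℝ)}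
    (hK : MeasurableSet K) (hsymm : ∀ z, -z ∈ K ↔ z ∈ K) (y : Fin d → ℝ) :
    Real.exp (-(c / 2) * (y ⬝ᵥ y)) * ∫ z, K.indicator (gaussWeight c) z ≤
      ∫ z, K.indicator (fun z => gaussWeight c (z + y)) z := by
  have hi : Integrable (K.indicator fun z => gaussWeight c (z + y)) :=
    ((integrable_gaussWeight hc).comp_add_right y).indicator hK
  have hneg := integral_neg_eq_self (K.indicator fun z => gaussWeight c (z + y)) volume
  have hi' := hi.comp_neg
  have hsum : ∫ z, K.indicator (fun z => gaussWeight c (z + y)) z =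
      ∫ z, (K.indicator (fun z => gaussWeight c (z + y)) z +
        K.indicator (fun z => gaussWeight c (z + y)) (-z)) / 2 := by
    rw [integral_div, integral_add hi hi', hneg]
    ring
  rw [hsum, ← integral_const_mul]
  refine integral_mono (((integrable_gaussWeight hc).indicator hK).const_mul _)
    ((hi.add hi').div_const 2) fun z => ?_
  by_cases hz : z ∈ K
  · simpa [hz, (hsymm z).2 hz] using exp_mul_gaussWeight_le c y z
  · simp [hz, (hsymm z).not.2 hz]

lemma card_le_of_disjoint_translates {d : ℕ} {c : ℝ} (hc : 0 < c) {K : Set (Fin d → ℝ)}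
    (hK : MeasurableSet K) (hsymm : ∀ z, -z ∈ K ↔ z ∈ K)
    (hhalf : ∫ z : Fin d → ℝ, gaussWeight c z ≤ 2 * ∫ z, K.indicator (gaussWeight c) z)
    (P : Finset (Fin d → ℝ)) (hP : ∀ y ∈ P, y ⬝ᵥ y ≤ 1)
    (hdisj : ∀ y ∈ P, ∀ y' ∈ P, ∀ z, z - y ∈ K → z - y' ∈ K → y = y') :
    (P.card : ℝ) ≤ 2 * Real.exp (c / 2) := by
  set Z := ∫ z : Fin d → ℝ, gaussWeight c z with hZ
  have hZpos : 0 < Z := integral_gaussWeight_pos hc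
  set f : (Fin d → ℝ) → (Fin d → ℝ) → ℝ :=
    fun y z => K.indicator (fun z => gaussWeight c (z + y)) (z - y) with hf
  have hfi : ∀ y, Integrable (f y) := fun y =>
    (((integrable_gaussWeight hc).comp_add_right y).indicator hK).comp_sub_right y
  have hlow : ∀ y ∈ P, Real.exp (-(c / 2)) * (Z / 2) ≤ ∫ z, f y z := by
    intro y hy
    rw [hf, integral_sub_right_eq_self (K.indicator fun z => gaussWeight c (z + y)) y]
    refine le_trans ?_ (exp_mul_integral_indicator_le hc hK hsymm y)
    have h1 : Real.exp (-(c / 2)) ≤ Real.exp (-(c / 2) * (y ⬝ᵥ y)) := by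
      apply Real.exp_le_exp.2
      nlinarith [hP y hy]
    exact mul_le_mul h1 (by linarith) (by positivity) (Real.exp_pos _).le
  have hup : ∑ y ∈ P, ∫ z, f y z ≤ Z := by
    rw [← integral_finsetSum _ fun y _ => hfi y]
    refine integral_mono (integrable_finsetSum _ fun y _ => hfi y) (integrable_gaussWeight hc) ?_
    intro z
    by_cases h : ∃ y ∈ P, z - y ∈ K
    · obtain ⟨y, hy, hyK⟩ := h
      have : ∑ y ∈ P, f y z = f y z := by
        refine Finset.sum_eq_single y (fun y' hy' hne => ?_) (fun h => absurd hy h)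
        exact Set.indicator_of_notMem (fun h' => hne (hdisj y' hy' y hy z h' hyK)) _
      change ∑ y ∈ P, f y z ≤ gaussWeight c z
      rw [this]
      simp [hf, hyK]
    · push Not at h
      have : ∑ y ∈ P, f y z = 0 :=
        Finset.sum_eq_zero fun y hy => Set.indicator_of_notMem (h y hy) _
      simpa [this] using (gaussWeight_pos c z).le
  have h := (Finset.card_nsmul_le_sum P _ _ hlow).trans hup
  rw [nsmul_eq_mul, Real.exp_neg] at h
  have he := Real.exp_pos (c / 2)
  have h2 : (P.card : ℝ) * ((Real.exp (c / 2))⁻¹ * (Z / 2)) =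
      P.card * Z / (2 * Real.exp (c / 2)) := by field_simp
  rw [h2, div_le_iff₀ (by positivity)] at h
  nlinarith

/-- A maximal separated subset of a set all of whose separated finite subsets have bounded
cardinality is a cover. -/
lemma exists_cover_of_card_separated_le {α : Type*} (S : Set α) (r : α → α → Prop)
    (hrefl : ∀ x, r x x) (hsymm : ∀ x y, r x y → r y x) (M : ℝ)
    (hM : ∀ P : Finset α, (∀ x ∈ P, x ∈ S) → (∀ x ∈ P, ∀ y ∈ P, r x y → x = y) →
      (P.card : ℝ) ≤ M) :
    ∃ N : Finset α, (N.card : ℝ) ≤ M ∧ ∀ x ∈ S, ∃ y ∈ N, r x y := by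
  classical
  set T : Set ℕ := {n | ∃ P : Finset α, ((∀ x ∈ P, x ∈ S) ∧
    ∀ x ∈ P, ∀ y ∈ P, r x y → x = y) ∧ P.card = n}
  have hne : T.Nonempty := ⟨0, ∅, by simp, rfl⟩
  have hbdd : BddAbove T := by
    refine ⟨⌊M⌋₊, ?_⟩
    rintro n ⟨P, ⟨h1, h2⟩, rfl⟩
    exact Nat.le_floor (hM P h1 h2)
  obtain ⟨P, ⟨h1, h2⟩, hcard⟩ := Nat.sSup_mem hne hbdd
  refine ⟨P, hM P h1 h2, fun x hx => ?_⟩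
  by_contra! hcon
  have hxP : x ∉ P := fun h => hcon x h (hrefl x)
  have hmem : (insert x P).card ∈ T := by
    refine ⟨insert x P, ⟨?_, ?_⟩, rfl⟩
    · simpa [hx] using h1
    · intro a ha b hb hab
      rcases Finset.mem_insert.1 ha with rfl | haP <;> rcases Finset.mem_insert.1 hb with rfl | hbP
      · rfl
      · exact absurd hab (hcon b hbP)
      · exact absurd (hsymm _ _ hab) (hcon a haP)
      · exact h2 a haP b hbP hab
  have := le_csSup hbdd hmem
  rw [Finset.card_insert_of_notMem hxP] at this
  omega

lemma abs_rpow_le_mul_exp {q s : ℝ} (hq : 0 < q) (hs : 0 < s) (x : ℝ) :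
    |x| ^ q ≤ (q / s) ^ q * Real.exp (-q) * (Real.exp (s * x) + Real.exp (-(s * x))) := by
  have h1 : s * |x| / q ≤ Real.exp (s * |x| / q - 1) := by
    have := Real.add_one_le_exp (s * |x| / q - 1)
    linarith
  have h2 : (s * |x| / q) ^ q ≤ Real.exp (s * |x|) * Real.exp (-q) := by
    refine (Real.rpow_le_rpow (by positivity) h1 hq.le).trans_eq ?_
    rw [← Real.exp_mul, ← Real.exp_add]
    congr 1
    field_simp
    ring
  have h3 : |x| ^ q = (q / s) ^ q * (s * |x| / q) ^ q := by
    rw [← Real.mul_rpow (by positivity) (by positivity)]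
    congr 1
    field_simp
  have h4 : Real.exp (s * |x|) ≤ Real.exp (s * x) + Real.exp (-(s * x)) := by
    rcases abs_cases x with ⟨h, _⟩ | ⟨h, _⟩ <;> rw [h]
    · linarith [Real.exp_pos (-(s * x))]
    · rw [mul_neg]; linarith [Real.exp_pos (s * x)]
  rw [h3, mul_assoc]
  refine mul_le_mul_of_nonneg_left (h2.trans ?_) (by positivity)
  rw [mul_comm]
  exact mul_le_mul_of_nonneg_left h4 (Real.exp_pos _).le

/-- A Gaussian-integrable majorant of `|⟨a, x⟩| ^ q` realising the `q`-th moment bound. -/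
lemma exists_majorant_abs_dotProduct_rpow {d : ℕ} {c q r : ℝ} (hc : 0 < c) (hq : 0 < q)
    (hr : 0 < r) (a : Fin d → ℝ) (ha : a ⬝ᵥ a ≤ r ^ 2) :
    ∃ f : (Fin d → ℝ) → ℝ, Integrable f ∧ (∀ x, |a ⬝ᵥ x| ^ q * gaussWeight c x ≤ f x) ∧
      ∫ x, f x ≤ 2 * ((q / c) ^ (q / 2) * r ^ q) * ∫ x : Fin d → ℝ, gaussWeight c x := by
  set s := √(q * c) / r with hs
  have hspos : 0 < s := by positivity
  have hi := integrable_exp_dotProduct_mul_gaussWeight hc (s • a)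
  have hi' := integrable_exp_dotProduct_mul_gaussWeight hc (-(s • a))
  refine ⟨fun x => (q / s) ^ q * Real.exp (-q) *
    (Real.exp ((s • a) ⬝ᵥ x) * gaussWeight c x + Real.exp ((-(s • a)) ⬝ᵥ x) * gaussWeight c x),
    (hi.add hi').const_mul _, fun x => ?_, ?_⟩
  · have := mul_le_mul_of_nonneg_right (abs_rpow_le_mul_exp hq hspos (a ⬝ᵥ x))
      (gaussWeight_pos c x).le
    simp only [neg_dotProduct, smul_dotProduct, smul_eq_mul]
    linarith
  · rw [integral_const_mul, integral_add hi hi', integral_exp_dotProduct_mul_gaussWeight hc,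
      integral_exp_dotProduct_mul_gaussWeight hc]
    have hZ := integral_gaussWeight_pos (d := d) hc
    have hs2 : s ^ 2 = q * c / r ^ 2 := by
      rw [hs, div_pow, Real.sq_sqrt (by positivity)]
    have h1 : (s • a) ⬝ᵥ (s • a) / (2 * c) ≤ q := by
      rw [smul_dotProduct, dotProduct_smul, smul_eq_mul, smul_eq_mul, ← mul_assoc, ← sq, hs2,
        div_le_iff₀ (by positivity), div_mul_eq_mul_div, div_le_iff₀ (by positivity)]
      have := mul_le_mul_of_nonneg_left ha (by positivity : 0 ≤ q * c)
      nlinarith [mul_pos hq hc, sq_nonneg r, mul_nonneg (mul_pos hq hc).le (sq_nonneg r)]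
    have h2 : (-(s • a)) ⬝ᵥ (-(s • a)) = (s • a) ⬝ᵥ (s • a) := by simp
    have h3 : (q / s) ^ q = (q / c) ^ (q / 2) * r ^ q := by
      have h4 : q / s = √(q / c) * r := by
        rw [hs, Real.sqrt_mul hq.le, Real.sqrt_div hq.le]
        have := Real.sqrt_pos.2 hq
        have := Real.sqrt_pos.2 hc
        field_simp
        rw [Real.sq_sqrt hq.le]
      rw [h4, Real.mul_rpow (by positivity) hr.le, Real.sqrt_eq_rpow,
        ← Real.rpow_mul (by positivity)]
      congr 2
      ring
    rw [h2, h3]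
    have h5 : Real.exp (-q) * Real.exp ((s • a) ⬝ᵥ (s • a) / (2 * c)) ≤ 1 := by
      rw [← Real.exp_add]
      exact Real.exp_le_one_iff.2 (by linarith)
    have h6 : 0 ≤ (q / c) ^ (q / 2) * r ^ q * ∫ x : Fin d → ℝ, gaussWeight c x := by positivity
    nlinarith [mul_le_mul_of_nonneg_left h5 h6]

lemma wNorm_le_iff {m : ℕ} {w : Fin m → ℝ} (hw : ∀ i, 0 ≤ w i) {q : ℝ} (hq : 0 < q)
    (v : Fin m → ℝ) {t : ℝ} (ht : 0 ≤ t) :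
    wNorm w q v ≤ t ↔ ∑ i, w i * |v i| ^ q ≤ t ^ q := by
  have h0 : 0 ≤ ∑ i, w i * |v i| ^ q :=
    Finset.sum_nonneg fun i _ => mul_nonneg (hw i) (by positivity)
  rw [wNorm, one_div, Real.rpow_inv_le_iff_of_pos h0 ht hq]

lemma wNorm_neg {m : ℕ} (w : Fin m → ℝ) (q : ℝ) (v : Fin m → ℝ) :
    wNorm w q (-v) = wNorm w q v := by
  simp [wNorm]

lemma wNorm_add_le {m : ℕ} {w : Fin m → ℝ} (hw : ∀ i, 0 ≤ w i) {q : ℝ} (hq : 1 ≤ q)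
    (u v : Fin m → ℝ) : wNorm w q (u + v) ≤ wNorm w q u + wNorm w q v := by
  have h : ∀ v : Fin m → ℝ, wNorm w q v =
      (∑ i, |w i ^ (1 / q) * v i| ^ q) ^ (1 / q) := by
    intro v
    rw [wNorm]
    congr 1
    refine Finset.sum_congr rfl fun i _ => ?_
    rw [abs_mul, abs_of_nonneg (Real.rpow_nonneg (hw i) _),
      Real.mul_rpow (Real.rpow_nonneg (hw i) _) (abs_nonneg _), ← Real.rpow_mul (hw i),
      one_div_mul_cancel (by linarith), Real.rpow_one]
  rw [h, h, h]
  simpa only [Pi.add_apply, mul_add] using Real.Lp_add_le Finset.univ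
    (fun i => w i ^ (1 / q) * u i) (fun i => w i ^ (1 / q) * v i) hq

lemma measurableSet_wNorm_mulVec_le {m d : ℕ} (w : Fin m → ℝ) {q : ℝ} (hq : 0 < q)
    (B : Matrix (Fin m) (Fin d) ℝ) (t : ℝ) : MeasurableSet {x | wNorm w q (B.mulVec x) ≤ t} := by
  have hc : Continuous fun x => wNorm w q (B.mulVec x) := by
    unfold wNorm
    refine Continuous.rpow_const (continuous_finsetSum _ fun i _ => ?_)
      fun _ => Or.inr (by positivity)
    refine continuous_const.mul (Continuous.rpow_const ?_ fun _ => Or.inr hq.le)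
    exact ((continuous_apply i).comp
      (Continuous.matrix_mulVec continuous_const continuous_id)).abs
  exact (isClosed_le hc continuous_const).measurableSet

lemma dotProduct_self_le_one_of_wNorm_two {m d : ℕ} {w : Fin m → ℝ} (hw : ∀ i, 0 ≤ w i)
    {B : Matrix (Fin m) (Fin d) ℝ} (hB : Bᵀ * Matrix.diagonal w * B = 1) {x : Fin d → ℝ}
    (hx : wNorm w 2 (B.mulVec x) ≤ 1) : x ⬝ᵥ x ≤ 1 := by
  rw [wNorm_le_iff hw two_pos _ zero_le_one, Real.one_rpow] at hx
  have h : x ⬝ᵥ x = ∑ i, w i * |B.mulVec x i| ^ (2 : ℝ) := by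
    calc x ⬝ᵥ x = x ⬝ᵥ ((Bᵀ * Matrix.diagonal w * B).mulVec x) := by rw [hB, one_mulVec]
      _ = (B.mulVec x) ⬝ᵥ ((Matrix.diagonal w).mulVec (B.mulVec x)) := by
        rw [← mulVec_mulVec, ← mulVec_mulVec, dotProduct_mulVec, vecMul_transpose]
      _ = _ := by
        refine Finset.sum_congr rfl fun i _ => ?_
        rw [mulVec_diagonal, Real.rpow_two, sq_abs]
        ring
  rw [h]
  exact hx

lemma mul_sqrt_div_rpow_le {q τ w : ℝ} (hq : 2 ≤ q) (hτ : 0 ≤ τ) (hw : 1 ≤ w) :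
    w * √(τ / w) ^ q ≤ τ ^ (q / 2) := by
  have hw0 : 0 < w := by linarith
  have h1 : √(τ / w) ^ q = (τ / w) ^ (q / 2) := by
    rw [Real.sqrt_eq_rpow, ← Real.rpow_mul (by positivity)]
    congr 1
    ring
  have h2 : w ≤ w ^ (q / 2) := Real.self_le_rpow_of_one_le hw (by linarith)
  rw [h1, Real.div_rpow hτ hw0.le, mul_div_assoc', div_le_iff₀ (by positivity), mul_comm]
  exact mul_le_mul_of_nonneg_left h2 (by positivity)

lemma mul_rpow_two_div_rpow {m : ℕ} {q τ : ℝ} (hq : 0 < q) (hτ : 0 ≤ τ) :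
    (τ * (m : ℝ) ^ (2 / q)) ^ (q / 2) = τ ^ (q / 2) * m := by
  rw [Real.mul_rpow hτ (by positivity), ← Real.rpow_mul (by positivity),
    div_mul_div_cancel₀ hq.ne', div_self two_ne_zero, Real.rpow_one]

lemma wNorm_mulVec_le_of_le {m d : ℕ} {q τ t : ℝ} (hq : 2 ≤ q) {w : Fin m → ℝ}
    (hw : ∀ i, 1 ≤ w i) {B : Matrix (Fin m) (Fin d) ℝ} (hτ0 : 0 ≤ τ)
    (hτ : ∀ i, B i ⬝ᵥ B i ≤ τ / w i) (ht : 0 < t) (h : τ * (m : ℝ) ^ (2 / q) ≤ t ^ 2)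
    {x : Fin d → ℝ} (hx : x ⬝ᵥ x ≤ 1) : wNorm w q (B.mulVec x) ≤ t := by
  have hq0 : 0 < q := by linarith
  rw [wNorm_le_iff (fun i => zero_le_one.trans (hw i)) hq0 _ ht.le]
  have hi : ∀ i ∈ Finset.univ, w i * |B.mulVec x i| ^ q ≤ τ ^ (q / 2) := by
    intro i _
    have hwi := hw i
    have hw0 : 0 < w i := by linarith
    refine le_trans ?_ (mul_sqrt_div_rpow_le hq hτ0 hwi)
    refine mul_le_mul_of_nonneg_left (Real.rpow_le_rpow (abs_nonneg _) ?_ hq0.le) hw0.le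
    refine Real.abs_le_sqrt ?_
    have hcs : (B i ⬝ᵥ x) ^ 2 ≤ (B i ⬝ᵥ B i) * (x ⬝ᵥ x) := by
      simpa only [dotProduct, sq] using Finset.sum_mul_sq_le_sq_mul_sq Finset.univ (B i) x
    have hx0 : 0 ≤ x ⬝ᵥ x := Finset.sum_nonneg fun j _ => mul_self_nonneg _
    have hb0 : 0 ≤ B i ⬝ᵥ B i := Finset.sum_nonneg fun j _ => mul_self_nonneg _
    calc (B.mulVec x i) ^ 2 ≤ (B i ⬝ᵥ B i) * (x ⬝ᵥ x) := hcs
      _ ≤ (B i ⬝ᵥ B i) * 1 := mul_le_mul_of_nonneg_left hx hb0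
      _ ≤ τ / w i := by rw [mul_one]; exact hτ i
  refine (Finset.sum_le_card_nsmul _ _ _ hi).trans ?_
  rw [nsmul_eq_mul, Finset.card_univ, Fintype.card_fin, mul_comm,
    ← mul_rpow_two_div_rpow hq0 hτ0]
  refine (Real.rpow_le_rpow (by positivity) h (by positivity)).trans_eq ?_
  rw [← Real.rpow_natCast, ← Real.rpow_mul ht.le]
  congr 1
  push_cast
  ring

/-- The weighted `ℓ_q` ball of radius `t / 2` has at least half of the Gaussian mass. -/
lemma integral_gaussWeight_le_two_mul_indicator {m d : ℕ} {q τ t : ℝ} (hq : 2 ≤ q)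
    {w : Fin m → ℝ} (hw : ∀ i, 1 ≤ w i) {B : Matrix (Fin m) (Fin d) ℝ} (hτ0 : 0 < τ)
    (hτ : ∀ i, B i ⬝ᵥ B i ≤ τ / w i) (ht : 0 < t) {c : ℝ} (hc : 0 < c)
    (hct : 16 * q * (τ * (m : ℝ) ^ (2 / q)) = c * t ^ 2) :
    ∫ z : Fin d → ℝ, gaussWeight c z ≤
      2 * ∫ z, {x | wNorm w q (B.mulVec x) ≤ t / 2}.indicator (gaussWeight c) z := by
  have hq0 : 0 < q := by linarith
  have hw0 : ∀ i, 0 < w i := fun i => zero_lt_one.trans_le (hw i)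
  set K := {x | wNorm w q (B.mulVec x) ≤ t / 2} with hKdef
  have hK : MeasurableSet K := measurableSet_wNorm_mulVec_le w hq0 B _
  set Z := ∫ z : Fin d → ℝ, gaussWeight c z with hZ
  have hZpos : 0 < Z := integral_gaussWeight_pos hc
  have hmaj := fun i => exists_majorant_abs_dotProduct_rpow (r := √(τ / w i)) hc hq0
    (Real.sqrt_pos.2 (div_pos hτ0 (hw0 i))) (B i)
    (by rw [Real.sq_sqrt (div_pos hτ0 (hw0 i)).le]; exact hτ i)
  choose f hfi hfle hfint using hmaj
  have hFi : Integrable fun x => ∑ i, w i * f i x :=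
    integrable_finsetSum _ fun i _ => (hfi i).const_mul _
  have hFint : ∫ x, ∑ i, w i * f i x ≤ 2 * (t / 4) ^ q * Z := by
    rw [integral_finsetSum _ fun i _ => (hfi i).const_mul _]
    have hi : ∀ i ∈ Finset.univ, ∫ x, w i * f i x ≤
        2 * ((q / c) ^ (q / 2) * τ ^ (q / 2)) * Z := by
      intro i _
      rw [integral_const_mul]
      have h1 := mul_le_mul_of_nonneg_left (hfint i) (hw0 i).le
      have h2 : 0 ≤ 2 * (q / c) ^ (q / 2) * Z := by positivity
      have h3 := mul_le_mul_of_nonneg_left (mul_sqrt_div_rpow_le hq hτ0.le (hw i)) h2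
      rw [← hZ] at h1
      linarith
    refine (Finset.sum_le_card_nsmul _ _ _ hi).trans_eq ?_
    rw [nsmul_eq_mul, Finset.card_univ, Fintype.card_fin]
    have h4 : (t / 4) ^ q = (q / c) ^ (q / 2) * (τ ^ (q / 2) * m) := by
      rw [← mul_rpow_two_div_rpow hq0 hτ0.le, ← Real.mul_rpow (by positivity) (by positivity)]
      have h5 : q / c * (τ * (m : ℝ) ^ (2 / q)) = (t / 4) ^ (2 : ℝ) := by
        rw [Real.rpow_two]
        field_simp
        linarith
      rw [h5, ← Real.rpow_mul (by positivity)]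
      congr 1
      ring
    rw [h4]
    ring
  have hpt : ∀ x, (t / 2) ^ q * gaussWeight c x ≤
      (t / 2) ^ q * K.indicator (gaussWeight c) x + ∑ i, w i * f i x := by
    intro x
    have hsum : (∑ i, w i * |B.mulVec x i| ^ q) * gaussWeight c x ≤ ∑ i, w i * f i x := by
      rw [Finset.sum_mul]
      refine Finset.sum_le_sum fun i _ => ?_
      rw [mul_assoc]
      exact mul_le_mul_of_nonneg_left (hfle i x) (hw0 i).le
    have hg := gaussWeight_pos c x
    by_cases hx : x ∈ K
    · have h0 : 0 ≤ (∑ i, w i * |B.mulVec x i| ^ q) * gaussWeight c x :=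
        mul_nonneg (Finset.sum_nonneg fun i _ => mul_nonneg (hw0 i).le (by positivity)) hg.le
      simp only [hx, Set.indicator_of_mem]
      linarith
    · have hx' : (t / 2) ^ q ≤ ∑ i, w i * |B.mulVec x i| ^ q := by
        rw [hKdef, Set.mem_ofPred_eq, wNorm_le_iff (fun i => (hw0 i).le) hq0 _ (by positivity)] at hx
        exact (not_le.1 hx).le
      simp only [hx, not_false_eq_true, Set.indicator_of_notMem, mul_zero, zero_add]
      exact (mul_le_mul_of_nonneg_right hx' hg.le).trans hsum
  have hKi := ((integrable_gaussWeight (d := d) hc).indicator hK).const_mul ((t / 2) ^ q)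
  have hint := integral_mono ((integrable_gaussWeight hc).const_mul _) (hKi.add hFi) hpt
  simp only [Pi.add_apply] at hint
  rw [integral_add hKi hFi, integral_const_mul, integral_const_mul, ← hZ] at hint
  have h6 : 4 * (t / 4) ^ q ≤ (t / 2) ^ q := by
    have h7 : (t / 2) ^ q = 2 ^ q * (t / 4) ^ q := by
      rw [← Real.mul_rpow (by positivity) (by positivity)]
      congr 1
      ring
    have h8 : (4 : ℝ) ≤ 2 ^ q := by
      have := Real.rpow_le_rpow_of_exponent_le (one_le_two (α := ℝ)) hq
      norm_num at this
      linarith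
    rw [h7]
    exact mul_le_mul_of_nonneg_right h8 (by positivity)
  have h9 : 0 < (t / 2) ^ q := by positivity
  have h10 := mul_le_mul_of_nonneg_right h6 hZpos.le
  refine le_of_mul_le_mul_left ?_ h9
  linarith

/-- Covering the weighted `ℓ_2` ball of a weighted-orthonormal matrix by weighted `ℓ_q`
balls of radius `t`, with `log`-covering number at most `C·m^{2/q}·q·τ/t²`. -/
theorem stmt11 :
    ∃ C : ℝ, 0 < C ∧
      ∀ (q : ℝ), 2 ≤ q →
      ∀ (m d : ℕ) (w : Fin m → ℝ), (∀ i, 1 ≤ w i) →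
      ∀ (B : Matrix (Fin m) (Fin d) ℝ), Bᵀ * Matrix.diagonal w * B = 1 →
      ∀ (τ : ℝ), (∀ i, w i * (∑ j, (B i j) ^ 2) ≤ τ) →
      ∀ t : ℝ, 0 < t →
        ∃ N : Finset (Fin d → ℝ),
          Real.log N.card ≤ C * (m : ℝ) ^ (2 / q) * q * τ / t ^ 2 ∧
          ∀ x : Fin d → ℝ, wNorm w 2 (B.mulVec x) ≤ 1 →
            ∃ x' ∈ N, wNorm w q (B.mulVec (x - x')) ≤ t := by
  refine ⟨9, by norm_num, ?_⟩
  intro q hq m d w hw B hB τ hτ t ht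
  have hq0 : 0 < q := by linarith
  have hw0 : ∀ i, 0 < w i := fun i => zero_lt_one.trans_le (hw i)
  rcases Nat.eq_zero_or_pos m with rfl | hm
  · refine ⟨{0}, ?_, fun x _ => ⟨0, by simp, ?_⟩⟩
    · simp [Real.zero_rpow (div_pos two_pos hq0).ne']
    · rw [wNorm_le_iff (fun i => (hw0 i).le) hq0 _ ht.le]
      simpa using Real.rpow_nonneg ht.le q
  have hτ0 : 0 ≤ τ := le_trans
    (mul_nonneg (hw0 ⟨0, hm⟩).le (Finset.sum_nonneg fun j _ => sq_nonneg _)) (hτ ⟨0, hm⟩)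
  have hτ' : ∀ i, B i ⬝ᵥ B i ≤ τ / w i := by
    intro i
    rw [le_div_iff₀ (hw0 i), mul_comm]
    simpa only [dotProduct, sq] using hτ i
  have hball : ∀ x : Fin d → ℝ, wNorm w 2 (B.mulVec x) ≤ 1 → x ⬝ᵥ x ≤ 1 := fun x hx =>
    dotProduct_self_le_one_of_wNorm_two (fun i => (hw0 i).le) hB hx
  rcases le_or_gt (τ * (m : ℝ) ^ (2 / q)) (t ^ 2) with h | h
  · refine ⟨{0}, ?_, fun x hx => ⟨0, by simp, ?_⟩⟩
    · simp only [Finset.card_singleton, Nat.cast_one, Real.log_one]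
      positivity
    · rw [sub_zero]
      exact wNorm_mulVec_le_of_le hq hw hτ0 hτ' ht h (hball x hx)
  have hτpos : 0 < τ := by
    refine lt_of_le_of_ne hτ0 ?_
    rintro rfl
    rw [zero_mul] at h
    linarith [sq_nonneg t]
  set s := τ * (m : ℝ) ^ (2 / q) with hs
  set c := 16 * q * s / t ^ 2 with hc_def
  have ht2 : 0 < t ^ 2 := by positivity
  have hspos : 0 < s := ht2.trans h
  have hc : 0 < c := by positivity
  have hct : 16 * q * s = c * t ^ 2 := by rw [hc_def]; field_simp
  have hhalf := integral_gaussWeight_le_two_mul_indicator hq hw hτpos hτ' ht hc hct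
  have hsymm : ∀ z, wNorm w q (B.mulVec (-z)) = wNorm w q (B.mulVec z) := fun z => by
    rw [mulVec_neg, wNorm_neg]
  obtain ⟨N, hN, hcov⟩ := exists_cover_of_card_separated_le
    {x : Fin d → ℝ | x ⬝ᵥ x ≤ 1} (fun x y => wNorm w q (B.mulVec (x - y)) ≤ t)
    (fun x => by
      rw [sub_self, mulVec_zero, wNorm_le_iff (fun i => (hw0 i).le) hq0 _ ht.le]
      simpa [Real.zero_rpow hq0.ne'] using Real.rpow_nonneg ht.le q)
    (fun x y hxy => by rwa [← neg_sub, hsymm]) (2 * Real.exp (c / 2))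
    (fun P hPS hPsep => card_le_of_disjoint_translates hc
      (measurableSet_wNorm_mulVec_le w hq0 B (t / 2)) (fun z => by simp [hsymm]) hhalf P hPS
      fun y hy y' hy' z hz hz' => hPsep y hy y' hy' (by
        have h1 : y - y' = -(z - y) + (z - y') := by abel
        rw [h1, mulVec_add]
        refine (wNorm_add_le (fun i => (hw0 i).le) (by linarith) _ _).trans ?_
        rw [hsymm]
        simp only [Set.mem_ofPred_eq] at hz hz'
        linarith))
  refine ⟨N, ?_, fun x hx => hcov x (hball x hx)⟩
  have hNpos : 0 < (N.card : ℝ) := by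
    obtain ⟨y, hy, -⟩ := hcov 0 (by simp)
    exact_mod_cast Finset.card_pos.2 ⟨y, hy⟩
  have hlog : Real.log N.card ≤ Real.log 2 + c / 2 := by
    rw [← Real.log_exp (c / 2), ← Real.log_mul two_ne_zero (Real.exp_pos _).ne']
    exact Real.log_le_log hNpos hN
  have hlog2 : Real.log 2 ≤ q * s / t ^ 2 := by
    have h1 : 1 ≤ q * s / t ^ 2 := by
      rw [le_div_iff₀ ht2]
      nlinarith
    linarith [Real.log_le_sub_one_of_pos (two_pos (α := ℝ))]
  have hfin : 9 * (m : ℝ) ^ (2 / q) * q * τ / t ^ 2 = q * s / t ^ 2 + c / 2 := by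
    rw [hc_def, hs]
    ring
  rw [hfin]
  linarith
end

section
/- There is a universal constant C > 0 such that the following holds. Let m ≥ 2, let w ∈ ℝ^m with w_i ≥ 1 for all i, let A' ∈ ℝ^{m×d} satisfy A'^T·diag(w)·A' = I_d, and let τ ≥ max_{i∈[m]} w_i·‖a_i'‖_2^2, where a_i' are the rows of A'. Then for every t > 0 there exists a finite set N ⊆ ℝ^d with log|N| ≤ C·(log m)·τ/t^2 such that for every x ∈ ℝ^d with ‖A'x‖_{w,2} ≤ 1 there exists x' ∈ N with max_{i∈[m]} |a_i'(x − x')| ≤ t. -/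
open Matrix

/-- If every row of `B` has squared length at most `τ`, then the set of `x` with
`τ ‖x‖² < (k + 1) t²` is covered by `(2 |ι| + 1) ^ k` translates of `{y | ‖B y‖_∞ ≤ t}`.
Moving `x` by `t / τ` against a row violating the bound lowers `τ ‖x‖²` by at least `t²`. -/
theorem exists_finset_cover_of_sum_sq_lt {ι κ : Type*} [Fintype ι] [Fintype κ]
    (B : Matrix ι κ ℝ) {τ t : ℝ} (hB : ∀ i, ∑ j, B i j ^ 2 ≤ τ) (ht : 0 < t) (k : ℕ) :
    ∃ N : Finset (κ → ℝ), 0 ∈ N ∧ N.card ≤ (2 * Fintype.card ι + 1) ^ k ∧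
      ∀ x : κ → ℝ, τ * ∑ j, x j ^ 2 < (k + 1) * t ^ 2 →
        ∃ x' ∈ N, ∀ i, |B.mulVec (x - x') i| ≤ t := by
  classical
  have cauchy (x : κ → ℝ) (i : ι) : B.mulVec x i ^ 2 ≤ τ * ∑ j, x j ^ 2 :=
    (Finset.sum_mul_sq_le_sq_mul_sq Finset.univ (B i) x).trans
      (mul_le_mul_of_nonneg_right (hB i) (Finset.sum_nonneg fun j _ => sq_nonneg _))
  induction k with
  | zero =>
    refine ⟨{0}, by simp, by simp, fun x hx => ⟨0, by simp, fun i => ?_⟩⟩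
    rw [sub_zero]
    refine abs_le_of_sq_le_sq ((cauchy x i).trans ?_) ht.le
    simpa using hx.le
  | succ k ih =>
    obtain ⟨N, h0, hcard, hN⟩ := ih
    let step (p : (κ → ℝ) × ι × Bool) : κ → ℝ :=
      p.1 + ((if p.2.2 then 1 else -1) * (t / τ)) • B p.2.1
    refine ⟨N ∪ (N ×ˢ Finset.univ).image step, Finset.mem_union_left _ h0, ?_, fun x hx => ?_⟩
    · calc (N ∪ (N ×ˢ Finset.univ).image step).card
          ≤ N.card + N.card * (Fintype.card ι * 2) := by
            refine (Finset.card_union_le _ _).trans (Nat.add_le_add_left ?_ _)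
            refine Finset.card_image_le.trans (le_of_eq ?_)
            simp [Finset.card_product]
        _ = N.card * (2 * Fintype.card ι + 1) := by ring
        _ ≤ (2 * Fintype.card ι + 1) ^ (k + 1) := by
            rw [pow_succ]
            exact Nat.mul_le_mul_right _ hcard
    · by_cases hgood : ∀ i, |B.mulVec x i| ≤ t
      · exact ⟨0, Finset.mem_union_left _ h0, by simpa using hgood⟩
      push Not at hgood
      obtain ⟨i, hi⟩ := hgood
      have hτ : 0 < τ := by
        have h1 : t ^ 2 < B.mulVec x i ^ 2 := by
          rw [← sq_abs (B.mulVec x i)]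
          exact pow_lt_pow_left₀ hi ht.le two_ne_zero
        refine pos_of_mul_pos_left ((pow_pos ht 2).trans (h1.trans_le (cauchy x i))) ?_
        exact Finset.sum_nonneg fun j _ => sq_nonneg _
      obtain ⟨b, hb⟩ : ∃ b : Bool, (if b then 1 else -1) * B.mulVec x i = |B.mulVec x i| := by
        rcases abs_choice (B.mulVec x i) with h | h
        · exact ⟨true, by simp [h]⟩
        · exact ⟨false, by simp [h]⟩
      set σ : ℝ := if b then 1 else -1 with hσ
      have hσ2 : σ ^ 2 = 1 := by rw [hσ]; split_ifs <;> norm_num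
      have expand : ∑ j, (x - (σ * (t / τ)) • B i) j ^ 2 =
          ∑ j, x j ^ 2 - 2 * (t / τ) * |B.mulVec x i| + (t / τ) ^ 2 * ∑ j, B i j ^ 2 := by
        rw [← hb, Matrix.mulVec, dotProduct, Finset.mul_sum, Finset.mul_sum, Finset.mul_sum,
          ← Finset.sum_sub_distrib, ← Finset.sum_add_distrib]
        refine Finset.sum_congr rfl fun j _ => ?_
        simp only [Pi.sub_apply, Pi.smul_apply, smul_eq_mul]
        linear_combination (t / τ) ^ 2 * B i j ^ 2 * hσ2
      have decrease : τ * ∑ j, (x - (σ * (t / τ)) • B i) j ^ 2 ≤ τ * ∑ j, x j ^ 2 - t ^ 2 := by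
        have h1 : τ * (2 * (t / τ) * |B.mulVec x i|) = 2 * t * |B.mulVec x i| := by
          field_simp
        have h2 : τ * ((t / τ) ^ 2 * ∑ j, B i j ^ 2) ≤ t ^ 2 := by
          calc τ * ((t / τ) ^ 2 * ∑ j, B i j ^ 2) ≤ τ * ((t / τ) ^ 2 * τ) := by
                gcongr
                exact hB i
            _ = t ^ 2 := by field_simp
        rw [expand, mul_add, mul_sub, h1]
        nlinarith
      obtain ⟨y, hy, hxy⟩ := hN (x - (σ * (t / τ)) • B i) (by
        push_cast at hx
        linarith)
      refine ⟨step (y, i, b), Finset.mem_union_right _ (Finset.mem_image_of_mem _ (by simp [hy])),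
        ?_⟩
      have : x - step (y, i, b) = x - (σ * (t / τ)) • B i - y := by
        simp only [step, ← hσ]
        abel
      rwa [this]

/-- If `Bᵀ diag(w) B = 1`, then `x ↦ B x` is an isometry into the weighted `ℓ_2` norm. -/
theorem sum_mul_mulVec_sq_eq {ι κ : Type*} [Fintype ι] [DecidableEq ι] [Fintype κ] [DecidableEq κ]
    {w : ι → ℝ} {B : Matrix ι κ ℝ} (h : Bᵀ * Matrix.diagonal w * B = 1) (x : κ → ℝ) :
    ∑ i, w i * B.mulVec x i ^ 2 = ∑ j, x j ^ 2 := by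
  have key : x ⬝ᵥ (Bᵀ * Matrix.diagonal w * B).mulVec x = x ⬝ᵥ x := by
    rw [h, Matrix.one_mulVec]
  rw [← Matrix.mulVec_mulVec, ← Matrix.mulVec_mulVec, Matrix.dotProduct_mulVec,
    Matrix.vecMul_transpose] at key
  simp only [dotProduct, Matrix.mulVec_diagonal] at key
  simp only [sq]
  rw [← key]
  exact Finset.sum_congr rfl fun i _ => by ring

theorem sum_mul_sq_le_one_of_wNorm_two_le_one {m : ℕ} {w v : Fin m → ℝ}
    (h : wNorm w 2 v ≤ 1) : ∑ i, w i * v i ^ 2 ≤ 1 := by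
  rw [wNorm, ← Real.sqrt_eq_rpow, Real.sqrt_le_one] at h
  simpa using h

/-- Covering the weighted `ℓ_2` ball of a weighted-orthonormal matrix by `ℓ_∞` balls of
radius `t`, with `log`-covering number at most `C·(log m)·τ/t²`. -/
theorem stmt12 :
    ∃ C : ℝ, 0 < C ∧
      ∀ (m d : ℕ), 2 ≤ m →
      ∀ (w : Fin m → ℝ), (∀ i, 1 ≤ w i) →
      ∀ (B : Matrix (Fin m) (Fin d) ℝ), Bᵀ * Matrix.diagonal w * B = 1 →
      ∀ (τ : ℝ), (∀ i, w i * (∑ j, (B i j) ^ 2) ≤ τ) →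
      ∀ t : ℝ, 0 < t →
        ∃ N : Finset (Fin d → ℝ),
          Real.log N.card ≤ C * Real.log m * τ / t ^ 2 ∧
          ∀ x : Fin d → ℝ, wNorm w 2 (B.mulVec x) ≤ 1 →
            ∃ x' ∈ N, ∀ i, |B.mulVec (x - x') i| ≤ t := by
  refine ⟨3, by norm_num, fun m d hm w hw B hB τ hτ t ht => ?_⟩
  have hrow (i : Fin m) : ∑ j, B i j ^ 2 ≤ τ :=
    (le_mul_of_one_le_left (Finset.sum_nonneg fun j _ => sq_nonneg _) (hw i)).trans (hτ i)
  have hτ0 : 0 ≤ τ :=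
    (Finset.sum_nonneg fun j _ => sq_nonneg _).trans (hrow ⟨0, by omega⟩)
  obtain ⟨N, h0, hcard, hN⟩ := exists_finset_cover_of_sum_sq_lt B hrow ht ⌊τ / t ^ 2⌋₊
  refine ⟨N, ?_, fun x hx => hN x ?_⟩
  · have hNpos : (0 : ℝ) < N.card := by exact_mod_cast Finset.card_pos.mpr ⟨0, h0⟩
    have hlog : Real.log (2 * m + 1 : ℕ) ≤ 3 * Real.log m := by
      have hpow : 2 * m + 1 ≤ m ^ 3 := by nlinarith [Nat.mul_le_mul hm hm]
      calc Real.log (2 * m + 1 : ℕ) ≤ Real.log ((m : ℝ) ^ 3) :=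
            Real.log_le_log (by positivity) (by exact_mod_cast hpow)
        _ = 3 * Real.log m := by simp [Real.log_pow]
    calc Real.log N.card ≤ Real.log (((2 * m + 1 : ℕ) : ℝ) ^ ⌊τ / t ^ 2⌋₊) :=
          Real.log_le_log hNpos (by simpa using (Nat.cast_le (α := ℝ)).mpr hcard)
      _ = ⌊τ / t ^ 2⌋₊ * Real.log (2 * m + 1 : ℕ) := Real.log_pow _ _
      _ ≤ τ / t ^ 2 * (3 * Real.log m) := by
          gcongr
          exact Nat.floor_le (by positivity)
      _ = 3 * Real.log m * τ / t ^ 2 := by ring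
  · have hx1 : ∑ j, x j ^ 2 ≤ 1 := by
      rw [← sum_mul_mulVec_sq_eq hB]
      exact sum_mul_sq_le_one_of_wNorm_two_le_one hx
    calc τ * ∑ j, x j ^ 2 ≤ τ := mul_le_of_le_one_right hτ0 hx1
      _ < (⌊τ / t ^ 2⌋₊ + 1) * t ^ 2 :=
          (div_lt_iff₀ (pow_pos ht 2)).mp (Nat.lt_floor_add_one _)
end

section
/- For every constant c ≥ 1 there is a constant C = C(c) > 0 such that the following holds. Let 2 < r < ∞, let m ≥ 2, d ≥ 2, let w ∈ ℝ^m with w_i ≥ 1 for all i, let A' ∈ ℝ^{m×d} satisfy A'^T·diag(w)·A' = I_d, and let τ ≥ max_{i∈[m]} w_i·‖a_i'‖_2^2, where a_i' are the rows of A'. Then for every t > 0 with 1/t ≤ m^c there exists a finite set N ⊆ ℝ^d with log|N| ≤ C·(1/(t/2)^{2r/(r−2)})·( (r/(r−2))·log d + log m )·τ such that for every x ∈ ℝ^d with ‖A'x‖_{w,2} ≤ 1 there exists x' ∈ N with ‖A'(x − x')‖_{w,r} ≤ t. -/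
open Matrix

/-- The empirical (greedy) approximation of the Euclidean unit ball: after `K` steps from a set of
at most `2m + 1` moves, either all functionals `a i` are `s`-small on the remainder, or the
squared norm of the remainder has dropped `K` times by `s ^ 2 / τ`. -/
theorem exists_greedy_net {ι κ : Type*} [Fintype ι] [Fintype κ]
    (a : ι → κ → ℝ) {s τ : ℝ} (hs : 0 < s) (ha : ∀ i, a i ⬝ᵥ a i ≤ τ) (K : ℕ) :
    ∃ N : Finset (κ → ℝ), N.card ≤ (2 * Fintype.card ι + 1) ^ K ∧
      ∀ x : κ → ℝ, x ⬝ᵥ x ≤ 1 → ∃ x' ∈ N, (x - x') ⬝ᵥ (x - x') ≤ 1 ∧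
        ((∀ i, |a i ⬝ᵥ (x - x')| ≤ s) ∨
          τ * ((x - x') ⬝ᵥ (x - x')) ≤ τ - K * s ^ 2) := by
  classical
  induction K with
  | zero =>
    refine ⟨{0}, by simp, fun x hx => ⟨0, by simp, by simpa using hx, ?_⟩⟩
    rcases isEmpty_or_nonempty ι with h | ⟨⟨i⟩⟩
    · exact Or.inl fun i => h.elim i
    · have hτ : 0 ≤ τ := (dotProduct_self_star_nonneg (a i)).trans (by simpa using ha i)
      right
      simpa using mul_le_of_le_one_right hτ hx
  | succ K ih =>
    obtain ⟨N, hN, hcov⟩ := ih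
    let S : Finset (κ → ℝ) := insert 0 (Finset.univ.image (fun i => (s / τ) • a i) ∪
      Finset.univ.image (fun i => -((s / τ) • a i)))
    have hS : S.card ≤ 2 * Fintype.card ι + 1 := by
      refine (Finset.card_insert_le _ _).trans (Nat.succ_le_succ ?_)
      refine (Finset.card_union_le _ _).trans ?_
      rw [two_mul]
      exact Nat.add_le_add Finset.card_image_le Finset.card_image_le
    refine ⟨Finset.image₂ (· + ·) N S, ?_, fun x hx => ?_⟩
    · rw [pow_succ]
      exact (Finset.card_image₂_le _ _ _).trans (Nat.mul_le_mul hN hS)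
    obtain ⟨x', hx', h1, h2⟩ := hcov x hx
    by_cases hgood : ∀ i, |a i ⬝ᵥ (x - x')| ≤ s
    · exact ⟨x' + 0, Finset.mem_image₂_of_mem hx' (Finset.mem_insert_self _ _),
        by simpa using h1, Or.inl (by simpa using hgood)⟩
    have h3 := h2.resolve_left hgood
    push Not at hgood
    obtain ⟨i, hi⟩ := hgood
    have hcs : (a i ⬝ᵥ (x - x')) ^ 2 ≤ (a i ⬝ᵥ a i) * ((x - x') ⬝ᵥ (x - x')) := by
      simpa [dotProduct, sq] using
        Finset.sum_mul_sq_le_sq_mul_sq Finset.univ (a i) (x - x')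
    have haa : 0 ≤ a i ⬝ᵥ a i := by simpa using dotProduct_self_star_nonneg (a i)
    have hτ : 0 < τ := by
      have : s ^ 2 < (a i ⬝ᵥ (x - x')) ^ 2 := by
        rw [← sq_abs (a i ⬝ᵥ (x - x'))]
        gcongr
      nlinarith [ha i, mul_le_of_le_one_right haa h1, sq_pos_of_pos hs]
    obtain ⟨σ, hσ, hσi, hmem⟩ : ∃ σ : ℝ, σ ^ 2 = 1 ∧ s < σ * (a i ⬝ᵥ (x - x')) ∧
        (σ * (s / τ)) • a i ∈ S := by
      rcases lt_abs.1 hi with h | h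
      · exact ⟨1, by norm_num, by simpa using h, by simp [S]⟩
      · exact ⟨-1, by norm_num, by simpa using h, by simp [S]⟩
    have key : τ * ((x - (x' + (σ * (s / τ)) • a i)) ⬝ᵥ (x - (x' + (σ * (s / τ)) • a i)))
        ≤ τ * ((x - x') ⬝ᵥ (x - x')) - s ^ 2 := by
      rw [← sub_sub]
      generalize x - x' = y at *
      have hexp : τ * ((y - (σ * (s / τ)) • a i) ⬝ᵥ (y - (σ * (s / τ)) • a i)) =
          τ * (y ⬝ᵥ y) - 2 * s * (σ * (a i ⬝ᵥ y)) + s ^ 2 * (a i ⬝ᵥ a i / τ) := by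
        simp only [sub_dotProduct, dotProduct_sub, smul_dotProduct, dotProduct_smul, smul_eq_mul,
          dotProduct_comm y (a i)]
        field_simp
        linear_combination s ^ 2 * (a i ⬝ᵥ a i) * hσ
      rw [hexp]
      have : a i ⬝ᵥ a i / τ ≤ 1 := (div_le_one hτ).2 (ha i)
      nlinarith [mul_le_mul_of_nonneg_left this (sq_nonneg s), mul_lt_mul_of_pos_left hσi hs]
    refine ⟨_, Finset.mem_image₂_of_mem hx' hmem, ?_, Or.inr ?_⟩
    · refine le_trans (le_of_mul_le_mul_left ?_ hτ) h1
      linarith [sq_nonneg s]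
    · push_cast
      linarith

/-- A dual Sudakov bound for polyhedral norms, with the distance to the centre controlled. -/
theorem exists_polyhedral_net {ι κ : Type*} [Fintype ι] [Fintype κ]
    (a : ι → κ → ℝ) {s τ : ℝ} (hs : 0 < s) (hτ : 0 ≤ τ) (ha : ∀ i, a i ⬝ᵥ a i ≤ τ) :
    ∃ N : Finset (κ → ℝ),
      Real.log N.card ≤ τ / s ^ 2 * Real.log (2 * Fintype.card ι + 1) ∧
      ∀ x : κ → ℝ, x ⬝ᵥ x ≤ 1 → ∃ x' ∈ N, (x - x') ⬝ᵥ (x - x') ≤ 1 ∧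
        ∀ i, |a i ⬝ᵥ (x - x')| ≤ s := by
  have hs2 : 0 < s ^ 2 := by positivity
  obtain ⟨N, hN, hcov⟩ := exists_greedy_net a hs ha ⌊τ / s ^ 2⌋₊
  refine ⟨N, ?_, fun x hx => ?_⟩
  · obtain ⟨x', hx', -⟩ := hcov 0 (by simp)
    have hpos : (0 : ℝ) < N.card := by exact_mod_cast Finset.card_pos.2 ⟨x', hx'⟩
    have hN' : (N.card : ℝ) ≤ (2 * Fintype.card ι + 1) ^ ⌊τ / s ^ 2⌋₊ := by exact_mod_cast hN
    refine (Real.log_le_log hpos hN').trans ?_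
    rw [Real.log_pow]
    refine mul_le_mul_of_nonneg_right (Nat.floor_le (by positivity)) (Real.log_nonneg ?_)
    linarith [Nat.cast_nonneg (α := ℝ) (Fintype.card ι)]
  · obtain ⟨x', hx', h1, h2⟩ := hcov x hx
    refine ⟨x', hx', h1, h2.elim id fun h i => abs_le_of_sq_le_sq ?_ hs.le⟩
    have hcs : (a i ⬝ᵥ (x - x')) ^ 2 ≤ (a i ⬝ᵥ a i) * ((x - x') ⬝ᵥ (x - x')) := by
      simpa [dotProduct, sq] using
        Finset.sum_mul_sq_le_sq_mul_sq Finset.univ (a i) (x - x')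
    have hyy : 0 ≤ (x - x') ⬝ᵥ (x - x') := by
      simpa using dotProduct_self_star_nonneg (x - x')
    have hfl := (div_lt_iff₀ hs2).1 (Nat.lt_floor_add_one (τ / s ^ 2))
    linarith [mul_le_mul_of_nonneg_right (ha i) hyy]

theorem sum_weighted_mulVec_sq {m d : ℕ} {w : Fin m → ℝ} {B : Matrix (Fin m) (Fin d) ℝ}
    (hB : Bᵀ * Matrix.diagonal w * B = 1) (x : Fin d → ℝ) :
    ∑ i, w i * (B.mulVec x i) ^ 2 = x ⬝ᵥ x := by
  calc ∑ i, w i * (B.mulVec x i) ^ 2 = B.mulVec x ⬝ᵥ (Matrix.diagonal w).mulVec (B.mulVec x) := by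
        simp only [dotProduct, Matrix.mulVec_diagonal]
        exact Finset.sum_congr rfl fun i _ => by ring
    _ = x ⬝ᵥ (Bᵀ * Matrix.diagonal w * B).mulVec x := by
        rw [← Matrix.mulVec_mulVec, ← Matrix.mulVec_mulVec, Matrix.dotProduct_mulVec x,
          Matrix.vecMul_transpose]
    _ = x ⬝ᵥ x := by rw [hB, Matrix.one_mulVec]

/-- Interpolation between the weighted `ℓ_2` norm and the sup norm. -/
theorem wNorm_le_of_abs_le {m : ℕ} {w v : Fin m → ℝ} (hw : ∀ i, 0 ≤ w i) {r s : ℝ} (hr : 2 < r)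
    (h2 : ∑ i, w i * v i ^ 2 ≤ 1) (hv : ∀ i, |v i| ≤ s) (hs : 0 ≤ s) :
    wNorm w r v ≤ s ^ ((r - 2) / r) := by
  have hr0 : 0 < r := by linarith
  have hsum : ∑ i, w i * |v i| ^ r ≤ s ^ (r - 2) := by
    calc ∑ i, w i * |v i| ^ r ≤ ∑ i, s ^ (r - 2) * (w i * v i ^ 2) := by
          refine Finset.sum_le_sum fun i _ => ?_
          have hsplit : |v i| ^ r = |v i| ^ (r - 2) * v i ^ 2 := by
            rw [← sq_abs (v i), ← Real.rpow_natCast, ← Real.rpow_add_of_nonneg (abs_nonneg _)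
              (by linarith) (by norm_num)]
            congr 1
            push_cast
            ring
          have hle : |v i| ^ (r - 2) ≤ s ^ (r - 2) :=
            Real.rpow_le_rpow (abs_nonneg _) (hv i) (by linarith)
          rw [hsplit]
          calc w i * (|v i| ^ (r - 2) * v i ^ 2) = |v i| ^ (r - 2) * (w i * v i ^ 2) := by ring
            _ ≤ s ^ (r - 2) * (w i * v i ^ 2) :=
              mul_le_mul_of_nonneg_right hle (mul_nonneg (hw i) (sq_nonneg _))
      _ = s ^ (r - 2) * ∑ i, w i * v i ^ 2 := by rw [Finset.mul_sum]
      _ ≤ s ^ (r - 2) := mul_le_of_le_one_right (Real.rpow_nonneg hs _) h2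
  have h0 : 0 ≤ ∑ i, w i * |v i| ^ r :=
    Finset.sum_nonneg fun i _ => mul_nonneg (hw i) (Real.rpow_nonneg (abs_nonneg _) _)
  calc wNorm w r v ≤ (s ^ (r - 2)) ^ (1 / r) := Real.rpow_le_rpow h0 hsum (by positivity)
    _ = s ^ ((r - 2) / r) := by rw [← Real.rpow_mul hs, mul_one_div]

/-- Interpolated covering bound: covering the weighted `ℓ_2` ball of a weighted-orthonormal
matrix by weighted `ℓ_r` balls of radius `t` (for `2 < r < ∞`, `1/t ≤ m^c`), with
`log`-covering number at most `C·(1/(t/2)^{2r/(r−2)})·((r/(r−2))·log d + log m)·τ`. -/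
theorem stmt13 :
    ∀ c : ℝ, 1 ≤ c →
      ∃ C : ℝ, 0 < C ∧
        ∀ (r : ℝ), 2 < r →
        ∀ (m d : ℕ), 2 ≤ m → 2 ≤ d →
        ∀ (w : Fin m → ℝ), (∀ i, 1 ≤ w i) →
        ∀ (B : Matrix (Fin m) (Fin d) ℝ), Bᵀ * Matrix.diagonal w * B = 1 →
        ∀ (τ : ℝ), (∀ i, w i * (∑ j, (B i j) ^ 2) ≤ τ) →
        ∀ t : ℝ, 0 < t → 1 / t ≤ (m : ℝ) ^ c →
          ∃ N : Finset (Fin d → ℝ),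
            Real.log N.card ≤
              C * (1 / (t / 2) ^ (2 * r / (r - 2))) *
                (r / (r - 2) * Real.log d + Real.log m) * τ ∧
            ∀ x : Fin d → ℝ, wNorm w 2 (B.mulVec x) ≤ 1 →
              ∃ x' ∈ N, wNorm w r (B.mulVec (x - x')) ≤ t := by
  intro c _
  refine ⟨3, by norm_num, ?_⟩
  intro r hr m d hm hd w hw B hB τ hτ t ht _
  have hr2 : 0 < r - 2 := by linarith
  have hr0 : 0 < r := by linarith
  have hw0 : ∀ i, 0 ≤ w i := fun i => zero_le_one.trans (hw i)
  have hrow : ∀ i, B i ⬝ᵥ B i ≤ τ := fun i => by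
    have h0 : 0 ≤ ∑ j, B i j ^ 2 := Finset.sum_nonneg fun j _ => sq_nonneg _
    calc B i ⬝ᵥ B i = ∑ j, B i j ^ 2 := by simp [dotProduct, sq]
      _ ≤ w i * ∑ j, B i j ^ 2 := le_mul_of_one_le_left h0 (hw i)
      _ ≤ τ := hτ i
  have hτ0 : 0 ≤ τ := by
    let i : Fin m := ⟨0, by omega⟩
    exact (by simpa using dotProduct_self_star_nonneg (B i) : 0 ≤ B i ⬝ᵥ B i).trans (hrow i)
  have hs : 0 < t ^ (r / (r - 2)) := Real.rpow_pos_of_pos ht _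
  obtain ⟨N, hN, hcov⟩ := exists_polyhedral_net (fun i => B i) hs hτ0 hrow
  refine ⟨N, ?_, fun x hx => ?_⟩
  · have hm2 : (2 : ℝ) ≤ m := by exact_mod_cast hm
    have hlogm : Real.log (2 * m + 1) ≤ 3 * Real.log m := by
      rw [show (3 : ℝ) = (3 : ℕ) by norm_num, ← Real.log_pow]
      exact Real.log_le_log (by positivity)
        (by nlinarith [mul_nonneg (sub_nonneg.2 hm2) (sub_nonneg.2 hm2)])
    have hlogm0 : 0 ≤ Real.log m := Real.log_nonneg (by linarith)
    have hlogd0 : 0 ≤ r / (r - 2) * Real.log d :=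
      mul_nonneg (by positivity) (Real.log_natCast_nonneg d)
    have hpow : (t ^ (r / (r - 2))) ^ 2 = t ^ (2 * r / (r - 2)) := by
      rw [← Real.rpow_natCast, ← Real.rpow_mul ht.le]
      congr 1
      push_cast
      ring
    have hinv : 1 / t ^ (2 * r / (r - 2)) ≤ 1 / (t / 2) ^ (2 * r / (r - 2)) :=
      one_div_le_one_div_of_le (Real.rpow_pos_of_pos (by positivity) _)
        (Real.rpow_le_rpow (by positivity) (by linarith) (by positivity))
    rw [Fintype.card_fin, hpow] at hN
    calc Real.log N.card ≤ τ / t ^ (2 * r / (r - 2)) * Real.log (2 * m + 1) := hN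
      _ ≤ τ / t ^ (2 * r / (r - 2)) * (3 * Real.log m) := by gcongr
      _ = 3 * (1 / t ^ (2 * r / (r - 2))) * Real.log m * τ := by ring
      _ ≤ 3 * (1 / (t / 2) ^ (2 * r / (r - 2))) *
            (r / (r - 2) * Real.log d + Real.log m) * τ := by
          gcongr
          linarith
  · have hx1 : x ⬝ᵥ x ≤ 1 := by
      rw [← sum_weighted_mulVec_sq hB x]
      simpa only [wNorm, Real.rpow_two, sq_abs, ← Real.sqrt_eq_rpow, Real.sqrt_le_one] using hx
    obtain ⟨x', hx', h1, h2⟩ := hcov x hx1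
    refine ⟨x', hx', ?_⟩
    rw [← sum_weighted_mulVec_sq hB] at h1
    refine (wNorm_le_of_abs_le hw0 hr h1 h2 hs.le).trans_eq ?_
    rw [← Real.rpow_mul ht.le, div_mul_div_cancel₀ hr2.ne', div_self hr0.ne', Real.rpow_one]
end
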